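/- Let H : F^p_α → L^p_α be a bounded operator such that H P_α : L^p_α → L^p_α is band-dominated, and suppose that for every g ∈ F^p_α one has ‖C_z H C_{−z} g‖_{L^p_α} → 0 as |z| → ∞. Then H is compact. -/

import Mathlib

open MeasureTheory Complex Filter Topology Bornology
open scoped ENNReal NNReal

noncomputable section

/-- `ℂ^n` with the Euclidean norm. -/
abbrev Cn (n : ℕ) := EuclideanSpace ℂ (Fin n)

instance (n : ℕ) : MeasurableSpace (Cn n) := borel _
instance (n : ℕ) : BorelSpace (Cn n) := ⟨rfl⟩

/-- The exponent `p` as an element of `ℝ≥0∞`. -/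
abbrev pe (p : ℝ) : ℝ≥0∞ := ENNReal.ofReal p

/-- The sesquilinear pairing `⟨w,z⟩ = ∑ w_j * conj (z_j)`. -/
def herm {n : ℕ} (w z : Cn n) : ℂ := ∑ j, w j * (starRingEnd ℂ) (z j)

/-- The Gaussian measure `dμ_β = (β/π)^n e^{-β|z|²} dv` on `ℂ^n`. -/
def gaussian (n : ℕ) (β : ℝ) : Measure (Cn n) :=
  volume.withDensity fun z => ENNReal.ofReal ((β / Real.pi) ^ n * Real.exp (-β * ‖z‖ ^ 2))

/-- The Fock space `F^p_α`: the (closed) subspace of `L^p` consisting of the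
(a.e. equivalence classes of) entire functions. -/
def fockSubmodule (n : ℕ) (p : ℝ≥0∞) (μ : Measure (Cn n)) :
    Submodule ℂ (Lp ℂ p μ) where
  carrier := {f | ∃ g : Cn n → ℂ, Differentiable ℂ g ∧ (f : Cn n → ℂ) =ᵐ[μ] g}
  add_mem' := by
    rintro f₁ f₂ ⟨g₁, hg₁, he₁⟩ ⟨g₂, hg₂, he₂⟩
    exact ⟨g₁ + g₂, hg₁.add hg₂, (Lp.coeFn_add f₁ f₂).trans (he₁.add he₂)⟩
  zero_mem' := ⟨0, differentiable_const 0, Lp.coeFn_zero ℂ p μ⟩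
  smul_mem' := by
    rintro c f ⟨g, hg, he⟩
    exact ⟨c • g, hg.const_smul c, (Lp.coeFn_smul c f).trans (he.const_smul c)⟩

/-- Defining property of the family of weighted shifts
`(C_z f)(w) = f(w-z) · e^{α⟨w,z⟩ - (α/2)|z|²}` on `L^p_α` over `ℂ^n`. -/
def IsFockShiftFamily (n : ℕ) (α : ℝ) (p : ℝ≥0∞) [Fact (1 ≤ p)] (μ : Measure (Cn n))
    (C : Cn n → (Lp ℂ p μ →L[ℂ] Lp ℂ p μ)) : Prop :=
  ∀ z : Cn n, ∀ f : Lp ℂ p μ,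
    (C z f : Cn n → ℂ) =ᵐ[μ]
      fun w => f (w - z) * Complex.exp ((α : ℂ) * herm w z - (α : ℂ) / 2 * (‖z‖ : ℂ) ^ 2)

/-- Defining properties of the projection `P_α` of `L^p_α` onto the Fock space `F^p_α`:
the integral formula `(P_α f)(z) = ∫ f(w) e^{α⟨z,w⟩} dμ_α(w)`, together with the fact that it is
a projection onto `F^p_α`. -/
def IsFockProjection (n : ℕ) (α : ℝ) (p : ℝ≥0∞) [Fact (1 ≤ p)] (μ : Measure (Cn n))
    (P : Lp ℂ p μ →L[ℂ] Lp ℂ p μ) : Prop :=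
  (∀ f : Lp ℂ p μ, ∀ᵐ z ∂μ,
      (P f : Cn n → ℂ) z
        = ∫ w, (f : Cn n → ℂ) w * Complex.exp ((α : ℂ) * herm z w) ∂(gaussian n α))
    ∧ (∀ f : Lp ℂ p μ, P f ∈ fockSubmodule n p μ)
    ∧ (∀ f ∈ fockSubmodule n p μ, P f = f)

/-- `M` is the operator of multiplication by the symbol `h` on `L^p`. -/
def IsMulOpBy {n : ℕ} {p : ℝ≥0∞} [Fact (1 ≤ p)] {μ : Measure (Cn n)}
    (h : Cn n → ℂ) (M : Lp ℂ p μ →L[ℂ] Lp ℂ p μ) : Prop :=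
  ∀ g : Lp ℂ p μ, (M g : Cn n → ℂ) =ᵐ[μ] fun w => h w * g w

/-- `A` is a band operator with respect to the metric `d`: there is a band width `ω > 0` such
that `M_f A M_g = 0` whenever `f, g ∈ L^∞` have essential supports of `d`-distance
greater than `ω`. -/
def IsBandOp {n : ℕ} {p : ℝ≥0∞} [Fact (1 ≤ p)] {μ : Measure (Cn n)} (d : Cn n → Cn n → ℝ)
    (A : Lp ℂ p μ →L[ℂ] Lp ℂ p μ) : Prop :=
  ∃ ω > (0 : ℝ), ∀ (f g : Cn n → ℂ) (S T : Set (Cn n)),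
    Measurable f → Measurable g →
    (∃ R, ∀ w, ‖f w‖ ≤ R) → (∃ R, ∀ w, ‖g w‖ ≤ R) →
    (∀ᵐ w ∂μ, w ∉ S → f w = 0) → (∀ᵐ w ∂μ, w ∉ T → g w = 0) →
    (∀ s ∈ S, ∀ t ∈ T, ω < d s t) →
    ∀ u v : Lp ℂ p μ, (v : Cn n → ℂ) =ᵐ[μ] (fun w => g w * u w) →
      (fun w => f w * (A v : Cn n → ℂ) w) =ᵐ[μ] 0

/-- `A` is band-dominated: it is a norm limit of band operators. -/
def IsBandDominated {n : ℕ} {p : ℝ≥0∞} [Fact (1 ≤ p)] {μ : Measure (Cn n)}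
    (d : Cn n → Cn n → ℝ) (A : Lp ℂ p μ →L[ℂ] Lp ℂ p μ) : Prop :=
  A ∈ closure {B : Lp ℂ p μ →L[ℂ] Lp ℂ p μ | IsBandOp d B}

/-! ### The unit ball / Bergman space setting -/

/-- The open unit ball `𝔹_n ⊆ ℂ^n`. -/
def unitBall (n : ℕ) : Set (Cn n) := Metric.ball 0 1

/-- The measure `dμ_α = c_α (1-|z|²)^α dv` on `𝔹_n`,
with `c_α = Γ(n+α+1)/(n! Γ(α+1))`. -/
def bergMeasure (n : ℕ) (α : ℝ) : Measure (Cn n) :=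
  (volume.restrict (unitBall n)).withDensity fun z =>
    ENNReal.ofReal
      ((Real.Gamma (n + α + 1) / ((Nat.factorial n : ℝ) * Real.Gamma (α + 1)))
        * (1 - ‖z‖ ^ 2) ^ α)

/-- The Möbius involution `φ_z` of `𝔹_n` interchanging `0` and `z`:
`φ_z(w) = (z - P_z w - s_z Q_z w)/(1 - ⟨w,z⟩)` where `P_z` is the orthogonal projection onto
`ℂ z`, `Q_z = I - P_z` and `s_z = √(1-|z|²)`. -/
def mobius {n : ℕ} (z w : Cn n) : Cn n :=
  (1 - herm w z)⁻¹ •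
    ((z - (herm w z / herm z z) • z) -
      ((Real.sqrt (1 - ‖z‖ ^ 2) : ℝ) : ℂ) • (w - (herm w z / herm z z) • z))

/-- The Bergman metric `d(z,w) = (1/2) log((1+|φ_z(w)|)/(1-|φ_z(w)|))` on `𝔹_n`. -/
def bergDist {n : ℕ} (z w : Cn n) : ℝ :=
  (1 / 2) * Real.log ((1 + ‖mobius z w‖) / (1 - ‖mobius z w‖))

/-- The filter of `z ∈ 𝔹_n` with `|z| → 1`, i.e. `z` tending to the boundary of the ball. -/
def ballBoundary (n : ℕ) : Filter (Cn n) :=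
  Filter.comap (fun z => ‖z‖) (𝓝 1) ⊓ Filter.principal (unitBall n)

/-- The Bergman space `A^p_α`: the (closed) subspace of `L^p` consisting of the
(a.e. equivalence classes of) holomorphic functions on the ball. -/
def bergSubmodule (n : ℕ) (p : ℝ≥0∞) (μ : Measure (Cn n)) :
    Submodule ℂ (Lp ℂ p μ) where
  carrier := {f | ∃ g : Cn n → ℂ, DifferentiableOn ℂ g (unitBall n) ∧ (f : Cn n → ℂ) =ᵐ[μ] g}
  add_mem' := by
    rintro f₁ f₂ ⟨g₁, hg₁, he₁⟩ ⟨g₂, hg₂, he₂⟩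
    exact ⟨g₁ + g₂, hg₁.add hg₂, (Lp.coeFn_add f₁ f₂).trans (he₁.add he₂)⟩
  zero_mem' := ⟨0, differentiableOn_const 0, Lp.coeFn_zero ℂ p μ⟩
  smul_mem' := by
    rintro c f ⟨g, hg, he⟩
    exact ⟨c • g, hg.const_smul c, (Lp.coeFn_smul c f).trans (he.const_smul c)⟩

/-- Defining property of the family of reflections
`(C_z f)(w) = f(φ_z(w)) (1-|z|²)^{(n+1+α)/p} / (1-⟨w,z⟩)^{2(n+1+α)/p}` on `L^p_α` over `𝔹_n`. -/
def IsBergReflFamily (n : ℕ) (α p : ℝ) [Fact (1 ≤ pe p)] (μ : Measure (Cn n))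
    (C : Cn n → (Lp ℂ (pe p) μ →L[ℂ] Lp ℂ (pe p) μ)) : Prop :=
  ∀ z : Cn n, ∀ f : Lp ℂ (pe p) μ,
    (C z f : Cn n → ℂ) =ᵐ[μ] fun w =>
      f (mobius z w) * (((1 - ‖z‖ ^ 2) ^ ((n + 1 + α) / p) : ℝ) : ℂ) /
        (1 - herm w z) ^ ((2 * (n + 1 + α) / p : ℝ) : ℂ)

/-- Defining properties of the Bergman projection `P_α` of `L^p_α` onto `A^p_α`:
the integral formula `(P_α f)(z) = ∫ f(w) (1-⟨z,w⟩)^{-(n+1+α)} dμ_α(w)`, together with the fact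
that it is a projection onto `A^p_α`. -/
def IsBergProjection (n : ℕ) (α : ℝ) (p : ℝ≥0∞) [Fact (1 ≤ p)] (μ : Measure (Cn n))
    (P : Lp ℂ p μ →L[ℂ] Lp ℂ p μ) : Prop :=
  (∀ f : Lp ℂ p μ, ∀ᵐ z ∂μ,
      (P f : Cn n → ℂ) z
        = ∫ w, (f : Cn n → ℂ) w * (1 - herm z w) ^ ((-(n + 1 + α) : ℝ) : ℂ) ∂(bergMeasure n α))
    ∧ (∀ f : Lp ℂ p μ, P f ∈ bergSubmodule n p μ)
    ∧ (∀ f ∈ bergSubmodule n p μ, P f = f)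


namespace FockAux

variable {n : ℕ}

lemma gaussian_density_measurable (n : ℕ) (β : ℝ) : Measurable (fun z : Cn n =>
    ENNReal.ofReal ((β / Real.pi) ^ n * Real.exp (-β * ‖z‖ ^ 2))) := by
  fun_prop

lemma gaussian_ac (n : ℕ) (β : ℝ) : gaussian n β ≪ volume :=
  withDensity_absolutelyContinuous _ _

lemma gaussian_ac' (n : ℕ) {β : ℝ} (hβ : 0 < β) : volume ≪ gaussian n β := by
  apply withDensity_absolutelyContinuous' (gaussian_density_measurable n β).aemeasurable
  refine Eventually.of_forall fun z => ?_
  have : 0 < (β / Real.pi) ^ n * Real.exp (-β * ‖z‖ ^ 2) := by positivity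
  simpa using this

lemma integrable_exp_sq (n : ℕ) {b : ℝ} (hb : 0 < b) :
    Integrable (fun z : Cn n => Real.exp (-b * ‖z‖ ^ 2)) volume := by
  have h := (GaussianFourier.integrable_cexp_neg_mul_sq_norm_add (V := Cn n) (b := (b : ℂ))
    (by simpa using hb) 0 0).norm
  refine h.congr (Eventually.of_forall fun z => ?_)
  simp only [Complex.norm_exp]
  congr 1
  simp [← Complex.ofReal_pow]

instance gaussian_sfinite (n : ℕ) (β : ℝ) : SFinite (gaussian n β) := by
  unfold gaussian; infer_instance

lemma gaussian_finite (n : ℕ) {β : ℝ} (hβ : 0 < β) : IsFiniteMeasure (gaussian n β) := by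
  unfold gaussian
  apply isFiniteMeasure_withDensity_ofReal
  exact ((integrable_exp_sq n hβ).const_mul _).2

/-- The weight that dominates everything. -/
lemma memLp_G (n : ℕ) {p α : ℝ} (hp : 1 < p) (hα : 0 < α) :
    MemLp (fun z : Cn n => Real.exp (α / 4 * ‖z‖ ^ 2)) (pe p) (gaussian n (p * α / 2)) := by
  have hp0 : 0 < p := by linarith
  rw [← integrable_norm_rpow_iff (by fun_prop) (by simpa using hp0) (by simp)]
  unfold gaussian
  rw [integrable_withDensity_iff_integrable_smul' (gaussian_density_measurable n _)
    (Eventually.of_forall fun _ => ENNReal.ofReal_lt_top)]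
  refine ((integrable_exp_sq n (b := p * α / 4) (by positivity)).const_mul
    ((p * α / 2 / Real.pi) ^ n)).congr (Eventually.of_forall fun z => ?_)
  simp only [smul_eq_mul]
  rw [ENNReal.toReal_ofReal (by positivity), ENNReal.toReal_ofReal hp0.le, Real.norm_eq_abs,
    abs_of_pos (Real.exp_pos _), ← Real.exp_mul, mul_assoc, ← Real.exp_add]
  congr 2
  ring

section Cut

variable {q : ℝ≥0∞} [Fact (1 ≤ q)] {μ : Measure (Cn n)}

/-- multiplication by an indicator, as a function -/
def cutFun (q : ℝ≥0∞) (μ : Measure (Cn n)) (S : Set (Cn n)) (hS : MeasurableSet S)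
    (f : Lp ℂ q μ) : Lp ℂ q μ := ((Lp.memLp f).indicator hS).toLp _

lemma coe_cutFun (S : Set (Cn n)) (hS : MeasurableSet S) (f : Lp ℂ q μ) :
    (cutFun q μ S hS f : Cn n → ℂ) =ᵐ[μ] S.indicator f := by
  unfold cutFun
  exact MemLp.coeFn_toLp _

lemma cutFun_add (S : Set (Cn n)) (hS : MeasurableSet S) (f g : Lp ℂ q μ) :
    cutFun q μ S hS (f + g) = cutFun q μ S hS f + cutFun q μ S hS g := by
  apply Lp.ext
  filter_upwards [coe_cutFun S hS (f + g), coe_cutFun S hS f, coe_cutFun S hS g,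
    Lp.coeFn_add f g, Lp.coeFn_add (cutFun q μ S hS f) (cutFun q μ S hS g)] with w h1 h2 h3 h4 h5
  rw [h5, Pi.add_apply, h1, h2, h3]
  by_cases h : w ∈ S
  · simp only [Set.indicator_of_mem h]
    exact h4
  · simp [h]

lemma cutFun_smul (S : Set (Cn n)) (hS : MeasurableSet S) (c : ℂ) (f : Lp ℂ q μ) :
    cutFun q μ S hS (c • f) = c • cutFun q μ S hS f := by
  apply Lp.ext
  filter_upwards [coe_cutFun S hS (c • f), coe_cutFun S hS f,
    Lp.coeFn_smul c f, Lp.coeFn_smul c (cutFun q μ S hS f)] with w h1 h2 h4 h5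
  rw [h5, Pi.smul_apply, h1, h2]
  by_cases h : w ∈ S
  · simp only [Set.indicator_of_mem h]
    exact h4
  · simp [h]

lemma norm_cutFun_le (S : Set (Cn n)) (hS : MeasurableSet S) (f : Lp ℂ q μ) :
    ‖cutFun q μ S hS f‖ ≤ ‖f‖ := by
  refine Lp.norm_le_norm_of_ae_le ?_
  filter_upwards [coe_cutFun S hS f] with w hw
  rw [hw]
  exact norm_indicator_le_norm_self _ _

/-- multiplication by an indicator -/
def cut (q : ℝ≥0∞) [Fact (1 ≤ q)] (μ : Measure (Cn n)) (S : Set (Cn n)) (hS : MeasurableSet S) :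
    Lp ℂ q μ →L[ℂ] Lp ℂ q μ :=
  LinearMap.mkContinuous
    { toFun := cutFun q μ S hS
      map_add' := cutFun_add S hS
      map_smul' := cutFun_smul S hS }
    1 (fun f => by
      rw [one_mul]
      exact norm_cutFun_le S hS f)

lemma coe_cut (S : Set (Cn n)) (hS : MeasurableSet S) (f : Lp ℂ q μ) :
    (cut q μ S hS f : Cn n → ℂ) =ᵐ[μ] S.indicator f :=
  coe_cutFun S hS f

lemma norm_cut_le (S : Set (Cn n)) (hS : MeasurableSet S) (f : Lp ℂ q μ) :
    ‖cut q μ S hS f‖ ≤ ‖f‖ := by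
  refine Lp.norm_le_norm_of_ae_le ?_
  filter_upwards [coe_cut S hS f] with w hw
  rw [hw]
  exact norm_indicator_le_norm_self _ _

lemma cut_add_compl (S : Set (Cn n)) (hS : MeasurableSet S) (f : Lp ℂ q μ) :
    cut q μ S hS f + cut q μ Sᶜ hS.compl f = f := by
  apply Lp.ext
  filter_upwards [coe_cut S hS f, coe_cut Sᶜ hS.compl f,
    Lp.coeFn_add (cut q μ S hS f) (cut q μ Sᶜ hS.compl f)] with w h1 h2 h3
  rw [h3, Pi.add_apply, h1, h2]
  by_cases h : w ∈ S <;> simp [h]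

lemma cut_cut (S : Set (Cn n)) (hS : MeasurableSet S) (f : Lp ℂ q μ) :
    cut q μ S hS (cut q μ S hS f) = cut q μ S hS f := by
  apply Lp.ext
  filter_upwards [coe_cut S hS f, coe_cut S hS (cut q μ S hS f)] with w h1 h2
  rw [h2]
  by_cases h : w ∈ S <;> simp [h, h1]

lemma cut_disj (S T : Set (Cn n)) (hS : MeasurableSet S) (hT : MeasurableSet T)
    (hST : ∀ w ∈ S, w ∉ T) (f : Lp ℂ q μ) :
    cut q μ S hS (cut q μ T hT f) = 0 := by
  apply Lp.ext
  filter_upwards [coe_cut T hT f, coe_cut S hS (cut q μ T hT f), Lp.coeFn_zero ℂ q μ]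
    with w h1 h2 h3
  rw [h2, h3]
  by_cases h : w ∈ S
  · simp [h, h1, hST w h]
  · simp [h]

lemma enorm_rpow {p : ℝ} (hp : 0 < p) (f : Lp ℂ (pe p) μ) :
    ‖f‖ₑ ^ p = ∫⁻ w, ‖f w‖ₑ ^ p ∂μ := by
  rw [Lp.enorm_def, eLpNorm_eq_lintegral_rpow_enorm_toReal (by simpa using hp) (by simp),
    ENNReal.toReal_ofReal hp.le, ← ENNReal.rpow_mul]
  rw [one_div, inv_mul_cancel₀ hp.ne', ENNReal.rpow_one]

lemma enorm_cut_rpow {p : ℝ} (hp : 0 < p) [Fact (1 ≤ pe p)] (S : Set (Cn n))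
    (hS : MeasurableSet S) (f : Lp ℂ (pe p) μ) :
    ‖cut (pe p) μ S hS f‖ₑ ^ p = ∫⁻ w, S.indicator (fun w => ‖f w‖ₑ ^ p) w ∂μ := by
  rw [enorm_rpow hp]
  apply lintegral_congr_ae
  filter_upwards [coe_cut S hS f] with w hw
  rw [hw]
  by_cases h : w ∈ S <;> simp [h, hp]

/-- Tonelli averaging. -/
lemma average [SFinite μ] (r : ℝ) (g : Cn n → ℝ≥0∞) (hg : AEMeasurable g μ) :
    ∫⁻ z, ∫⁻ w, (Metric.ball z r).indicator g w ∂μ ∂(volume : Measure (Cn n))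
      = volume (Metric.ball (0 : Cn n) r) * ∫⁻ w, g w ∂μ := by
  rw [lintegral_lintegral_swap]
  · rw [← lintegral_const_mul'' _ hg]
    refine lintegral_congr fun w => ?_
    have : (fun z => (Metric.ball z r).indicator g w)
        = (Metric.ball w r).indicator (fun _ => g w) := by
      ext z
      by_cases h : dist w z < r
      · simp [h, dist_comm z w]
      · simp [h, dist_comm z w]
    rw [this, lintegral_indicator Metric.isOpen_ball.measurableSet, lintegral_const,
      Measure.restrict_apply_univ, mul_comm, Measure.addHaar_ball_center]
  · have : Function.uncurry (fun (z w : Cn n) => (Metric.ball z r).indicator g w)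
        = {x : Cn n × Cn n | dist x.2 x.1 < r}.indicator (fun x => g x.2) := by
      ext ⟨z, w⟩
      by_cases h : dist w z < r <;> simp [h, Function.uncurry]
    rw [this]
    refine AEMeasurable.indicator ?_ (measurableSet_lt (by fun_prop) (by fun_prop))
    exact hg.comp_quasiMeasurePreserving Measure.quasiMeasurePreserving_snd

lemma mball (z : Cn n) (r : ℝ) : MeasurableSet (Metric.ball z r) :=
  Metric.isOpen_ball.measurableSet

/-- Localization for band operators. -/
lemma band_localization {p : ℝ} (hp : 0 < p) [Fact (1 ≤ pe p)] [SFinite μ]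
    (B : Lp ℂ (pe p) μ →L[ℂ] Lp ℂ (pe p) μ) {ω : ℝ} (hω : 0 < ω)
    (hB : ∀ (f g : Cn n → ℂ) (S T : Set (Cn n)),
      Measurable f → Measurable g →
      (∃ R, ∀ w, ‖f w‖ ≤ R) → (∃ R, ∀ w, ‖g w‖ ≤ R) →
      (∀ᵐ w ∂μ, w ∉ S → f w = 0) → (∀ᵐ w ∂μ, w ∉ T → g w = 0) →
      (∀ s ∈ S, ∀ t ∈ T, ω < dist s t) →
      ∀ u v : Lp ℂ (pe p) μ, (v : Cn n → ℂ) =ᵐ[μ] (fun w => g w * u w) →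
      (fun w => f w * (B v : Cn n → ℂ) w) =ᵐ[μ] 0)
    {δ : ℝ} (hδ : 0 ≤ δ) (f : Lp ℂ (pe p) μ)
    (hf : ∀ z, ‖B (cut (pe p) μ (Metric.ball z (3 * ω)) (mball _ _) f)‖
      ≤ δ * ‖cut (pe p) μ (Metric.ball z (3 * ω)) (mball _ _) f‖) :
    ‖B f‖ ≤ ((3 : ℝ) ^ Module.finrank ℝ (Cn n)) ^ (1 / p) * δ * ‖f‖ := by
  have key : ∀ z, ∫⁻ w, (Metric.ball z ω).indicator (fun w => ‖B f w‖ₑ ^ p) w ∂μ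
      ≤ ENNReal.ofReal δ ^ p *
        ∫⁻ w, (Metric.ball z (3 * ω)).indicator (fun w => ‖f w‖ₑ ^ p) w ∂μ := by
    intro z
    set T := Metric.ball z (3 * ω) with hT
    have h0 := hB ((Metric.ball z ω).indicator 1) (Tᶜ.indicator 1) (Metric.ball z ω) Tᶜ
      (measurable_one.indicator (mball _ _)) (measurable_one.indicator (mball _ _).compl)
      ⟨1, fun w => by by_cases h : w ∈ Metric.ball z ω <;> simp [h]⟩
      ⟨1, fun w => by by_cases h : w ∈ Tᶜ <;> simp [h]⟩
      (Eventually.of_forall fun w hw => by simp [hw])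
      (Eventually.of_forall fun w hw => by simp [hw])
      (by
        intro s hs t ht
        simp only [hT, Metric.mem_ball, Set.mem_compl_iff, not_lt] at hs ht
        have := dist_triangle t s z
        rw [dist_comm t s] at this
        linarith)
      f (cut (pe p) μ Tᶜ (mball _ _).compl f)
      (by
        filter_upwards [coe_cut Tᶜ (mball z (3 * ω)).compl f] with w hw
        rw [hw]
        by_cases h : w ∈ T <;> simp [h])
    rw [← enorm_cut_rpow hp _ (mball _ _), ← enorm_cut_rpow hp _ (mball _ _)]
    have e1 : cut (pe p) μ (Metric.ball z ω) (mball _ _) (B f)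
        = cut (pe p) μ (Metric.ball z ω) (mball _ _) (B (cut (pe p) μ T (mball _ _) f)) := by
      conv_lhs => rw [← cut_add_compl T (mball _ _) f, map_add, map_add]
      rw [add_eq_left]
      apply Lp.ext
      filter_upwards [h0, Lp.coeFn_zero ℂ (pe p) μ, coe_cut (Metric.ball z ω) (mball _ _)
        (B (cut (pe p) μ Tᶜ (mball _ _).compl f))] with w h1 h2 h3
      rw [h2, h3]
      by_cases h : w ∈ Metric.ball z ω
      · simpa [h] using h1
      · simp [h]
    rw [e1, ← ENNReal.mul_rpow_of_nonneg _ _ hp.le]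
    refine ENNReal.rpow_le_rpow ?_ hp.le
    rw [← ofReal_norm, ← ofReal_norm, ← ENNReal.ofReal_mul hδ]
    exact ENNReal.ofReal_le_ofReal ((norm_cut_le _ _ _).trans (hf z))
  have hm : ∀ u : Lp ℂ (pe p) μ, AEMeasurable (fun w => ‖u w‖ₑ ^ p) μ := fun u =>
    (Lp.aestronglyMeasurable u).enorm.pow_const _
  have h1 := lintegral_mono (μ := (volume : Measure (Cn n))) key
  rw [lintegral_const_mul' _ _ (ENNReal.rpow_ne_top_of_nonneg hp.le ENNReal.ofReal_ne_top),
    average _ _ (hm _), average _ _ (hm _),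
    Measure.addHaar_ball_mul_of_pos _ _ (by norm_num), ← enorm_rpow hp, ← enorm_rpow hp] at h1
  have hv0 : volume (Metric.ball (0 : Cn n) ω) ≠ 0 := (Metric.measure_ball_pos _ _ hω).ne'
  have hvt : volume (Metric.ball (0 : Cn n) ω) ≠ ∞ := measure_ball_lt_top.ne
  set N : ℝ := (3 : ℝ) ^ Module.finrank ℝ (Cn n) with hN
  have hN0 : 0 ≤ N := by positivity
  have h2 : ‖B f‖ₑ ^ p ≤ ENNReal.ofReal N * ENNReal.ofReal δ ^ p * ‖f‖ₑ ^ p := by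
    rw [← ENNReal.mul_le_mul_iff_right hv0 hvt]
    calc _ ≤ _ := h1
      _ = _ := by ring
  have h3 : ‖B f‖ ^ p ≤ N * δ ^ p * ‖f‖ ^ p := by
    rw [← ofReal_norm, ← ofReal_norm, ENNReal.ofReal_rpow_of_nonneg (norm_nonneg _) hp.le,
      ENNReal.ofReal_rpow_of_nonneg (norm_nonneg _) hp.le,
      ENNReal.ofReal_rpow_of_nonneg hδ hp.le, ← ENNReal.ofReal_mul hN0,
      ← ENNReal.ofReal_mul (by positivity)] at h2
    exact (ENNReal.ofReal_le_ofReal_iff (by positivity)).1 h2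
  rw [← Real.rpow_le_rpow_iff (norm_nonneg _) (by positivity) hp,
    Real.mul_rpow (by positivity) (by positivity), Real.mul_rpow (by positivity) hδ,
    ← Real.rpow_mul hN0, one_div, inv_mul_cancel₀ hp.ne', Real.rpow_one]
  exact h3

end Cut

lemma herm_add_left (a b c : Cn n) : herm (a + b) c = herm a c + herm b c := by
  simp [herm, add_mul, Finset.sum_add_distrib]

lemma herm_add_right (a b c : Cn n) : herm a (b + c) = herm a b + herm a c := by
  simp [herm, mul_add, Finset.sum_add_distrib]

lemma herm_sub_left (a b c : Cn n) : herm (a - b) c = herm a c - herm b c := by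
  simp [herm, sub_mul, Finset.sum_sub_distrib]

lemma herm_sub_right (a b c : Cn n) : herm a (b - c) = herm a b - herm a c := by
  simp [herm, mul_sub, Finset.sum_sub_distrib]

lemma herm_eq_inner (a b : Cn n) : herm a b = inner ℂ b a := by
  simp [herm, PiLp.inner_apply]

lemma herm_self (a : Cn n) : herm a a = (‖a‖ : ℂ) ^ 2 := by
  rw [herm_eq_inner, inner_self_eq_norm_sq_to_K]; rfl

lemma norm_herm_le (a b : Cn n) : ‖herm a b‖ ≤ ‖a‖ * ‖b‖ := by
  rw [herm_eq_inner, mul_comm]; exact norm_inner_le_norm _ _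

lemma continuous_herm_left (b : Cn n) : Continuous (fun a : Cn n => herm a b) := by
  unfold herm; fun_prop

lemma continuous_herm_right (a : Cn n) : Continuous (fun b : Cn n => herm a b) := by
  unfold herm; fun_prop

lemma integral_gaussian (n : ℕ) {β : ℝ} (hβ : 0 < β) (g : Cn n → ℂ) :
    ∫ w, g w ∂(gaussian n β)
      = ∫ w, (((β / Real.pi) ^ n : ℝ) : ℂ) * cexp (-(β : ℂ) * herm w w) * g w := by
  unfold gaussian
  rw [integral_withDensity_eq_integral_toReal_smul (gaussian_density_measurable n β)
    (Eventually.of_forall fun _ => ENNReal.ofReal_lt_top)]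
  congr 1
  ext w
  rw [ENNReal.toReal_ofReal (by positivity), herm_self]
  simp

lemma ae_translate {β : ℝ} (hβ : 0 < β) (z : Cn n) {q : Cn n → Prop}
    (h : ∀ᵐ w ∂(gaussian n β), q w) : ∀ᵐ w ∂(gaussian n β), q (w - z) := by
  have h1 : ∀ᵐ w ∂(volume : Measure (Cn n)), q w := (gaussian_ac' n hβ).ae_le h
  have h2 := (quasiMeasurePreserving_add_right (volume : Measure (Cn n)) (-z)).ae h1
  have h3 := (gaussian_ac n β).ae_le h2
  simp only [sub_eq_add_neg]
  exact h3

section Shift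

variable {p α : ℝ} [Fact (1 ≤ pe p)] 

lemma P_comm {β : ℝ} (hβ : 0 < β) (hα : 0 < α)
    (P : Lp ℂ (pe p) (gaussian n β) →L[ℂ] Lp ℂ (pe p) (gaussian n β))
    (hP : IsFockProjection n α (pe p) (gaussian n β) P)
    (C : Cn n → (Lp ℂ (pe p) (gaussian n β) →L[ℂ] Lp ℂ (pe p) (gaussian n β)))
    (hC : IsFockShiftFamily n α (pe p) (gaussian n β) C) (z : Cn n)
    (f : Lp ℂ (pe p) (gaussian n β)) : P (C z f) = C z (P f) := by
  apply Lp.ext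
  filter_upwards [hP.1 (C z f), hC z (P f), ae_translate hβ z (hP.1 f)] with w h1 h2 h3
  rw [h1, h2, h3]
  have h4 : (C z f : Cn n → ℂ) =ᵐ[gaussian n α]
      fun w => f (w - z) * cexp ((α : ℂ) * herm w z - (α : ℂ) / 2 * (‖z‖ : ℂ) ^ 2) :=
    (gaussian_ac n α).ae_le ((gaussian_ac' n hβ).ae_le (hC z f))
  have h5 : ∫ u, (C z f : Cn n → ℂ) u * cexp ((α : ℂ) * herm w u) ∂(gaussian n α)
      = ∫ u, (f (u - z) * cexp ((α : ℂ) * herm u z - (α : ℂ) / 2 * (‖z‖ : ℂ) ^ 2))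
        * cexp ((α : ℂ) * herm w u) ∂(gaussian n α) := by
    apply integral_congr_ae
    filter_upwards [h4] with u hu
    rw [hu]
  rw [h5, integral_gaussian n hα, integral_gaussian n hα, ← integral_mul_const,
    ← integral_add_right_eq_self _ z]
  congr 1
  ext u
  rw [add_sub_cancel_right, ← herm_self]
  simp only [mul_assoc]
  congr 1
  rw [mul_left_comm, mul_left_comm (cexp _) (f u)]
  congr 1
  simp only [← Complex.exp_add]
  congr 1
  simp only [herm_add_left, herm_add_right, herm_sub_left]
  ring

lemma C_cut {β : ℝ} (hβ : 0 < β)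
    (C : Cn n → (Lp ℂ (pe p) (gaussian n β) →L[ℂ] Lp ℂ (pe p) (gaussian n β)))
    (hC : IsFockShiftFamily n α (pe p) (gaussian n β) C) (z a : Cn n) (r : ℝ)
    (f : Lp ℂ (pe p) (gaussian n β)) :
    C z (cut _ _ (Metric.ball a r) (mball _ _) f)
      = cut _ _ (Metric.ball (a + z) r) (mball _ _) (C z f) := by
  apply Lp.ext
  filter_upwards [hC z (cut _ _ (Metric.ball a r) (mball _ _) f), hC z f,
    ae_translate hβ z (coe_cut (Metric.ball a r) (mball _ _) f),
    coe_cut (Metric.ball (a + z) r) (mball _ _) (C z f)] with w h1 h2 h3 h4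
  rw [h1, h3, h4]
  have : w - z ∈ Metric.ball a r ↔ w ∈ Metric.ball (a + z) r := by
    simp only [Metric.mem_ball, dist_eq_norm]
    rw [show w - (a + z) = w - z - a by abel]
  by_cases h : w ∈ Metric.ball (a + z) r
  · rw [Set.indicator_of_mem h, Set.indicator_of_mem (this.2 h), h2]
  · rw [Set.indicator_of_notMem h, Set.indicator_of_notMem (mt this.1 h), zero_mul]

end Shift

lemma norm_exp_sub_le {a b : ℂ} {ρ : ℝ} (ha : ‖a‖ ≤ ρ) (hb : ‖b‖ ≤ ρ) :
    ‖cexp a - cexp b‖ ≤ Real.exp ρ * ‖a - b‖ := by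
  refine Convex.norm_image_sub_le_of_norm_deriv_le (𝕜 := ℂ) (s := Metric.closedBall 0 ρ)
    (fun x _ => Complex.differentiable_exp x) (fun x hx => ?_) (convex_closedBall 0 ρ)
    (by simpa using hb) (by simpa using ha)
  rw [Complex.deriv_exp, Complex.norm_exp]
  apply Real.exp_le_exp.2
  exact (Complex.re_le_norm x).trans (by simpa using hx)

lemma exp_le_G {α : ℝ} (hα : 0 < α) (s t : ℝ) :
    Real.exp (s * t) ≤ Real.exp (s ^ 2 / α) * Real.exp (α / 4 * t ^ 2) := by
  rw [← Real.exp_add]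
  apply Real.exp_le_exp.2
  have : s ^ 2 / α + α / 4 * t ^ 2 - s * t = (s - α / 2 * t) ^ 2 / α := by
    field_simp
    ring
  have h2 : 0 ≤ (s - α / 2 * t) ^ 2 / α := by positivity
  linarith

lemma memLp_kernel {p α : ℝ} (hp : 1 < p) (hα : 0 < α) (y : Cn n) :
    MemLp (fun z : Cn n => cexp ((α : ℂ) * herm z y)) (pe p) (gaussian n (p * α / 2)) := by
  refine (memLp_G n hp hα).of_le_mul (c := Real.exp ((α * ‖y‖) ^ 2 / α)) ?_
    (Eventually.of_forall fun z => ?_)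
  · have := continuous_herm_left y
    fun_prop
  · rw [Real.norm_eq_abs, abs_of_pos (Real.exp_pos _), Complex.norm_exp]
    refine le_trans (Real.exp_le_exp.2 ?_) (exp_le_G hα _ _)
    refine (Complex.re_le_norm _).trans ?_
    rw [norm_mul, Complex.norm_real, Real.norm_eq_abs, abs_of_pos hα, mul_assoc, mul_comm ‖y‖]
    exact mul_le_mul_of_nonneg_left (norm_herm_le _ _) hα.le

/-- local L1 bound -/
lemma local_L1 {p α : ℝ} (hp : 1 < p) (hα : 0 < α) (n : ℕ) (r : ℝ) :
    ∃ M : ℝ, 0 ≤ M ∧ ∀ f : Lp ℂ (pe p) (gaussian n (p * α / 2)),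
      Integrable f ((gaussian n α).restrict (Metric.ball 0 r)) ∧
      ∫ w in Metric.ball 0 r, ‖f w‖ ∂(gaussian n α) ≤ M * ‖f‖ := by
  set β := p * α / 2 with hβ
  have hβ0 : 0 < β := by positivity
  have := gaussian_finite n hβ0
  set c : ℝ := (α / Real.pi) ^ n / (β / Real.pi) ^ n * Real.exp (β * r ^ 2) with hc
  have hc0 : 0 ≤ c := by positivity
  have hle : (gaussian n α).restrict (Metric.ball 0 r) ≤ ENNReal.ofReal c • gaussian n β := by
    unfold gaussian
    rw [restrict_withDensity (mball _ _), ← withDensity_smul _ (gaussian_density_measurable n β),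
      ← withDensity_indicator (mball _ _)]
    refine withDensity_mono (Eventually.of_forall fun w => ?_)
    by_cases h : w ∈ Metric.ball (0 : Cn n) r
    · rw [Set.indicator_of_mem h, Pi.smul_apply, smul_eq_mul, ← ENNReal.ofReal_mul hc0]
      apply ENNReal.ofReal_le_ofReal
      have h1 : ‖w‖ < r := by simpa using h
      have h2 : ‖w‖ ^ 2 ≤ r ^ 2 := by gcongr
      have h3 : c * ((β / Real.pi) ^ n * Real.exp (-β * ‖w‖ ^ 2))
          = (α / Real.pi) ^ n * (Real.exp (β * r ^ 2) * Real.exp (-β * ‖w‖ ^ 2)) := by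
        rw [hc]; field_simp
      rw [h3, ← Real.exp_add]
      refine mul_le_mul_of_nonneg_left (Real.exp_le_exp.2 ?_) (by positivity)
      have : 0 ≤ α * ‖w‖ ^ 2 := by positivity
      nlinarith
    · rw [Set.indicator_of_notMem h]; exact zero_le
  set m : ℝ≥0∞ := gaussian n β Set.univ ^ (1 / (1 : ℝ≥0∞).toReal - 1 / (pe p).toReal) with hm
  have hmt : m ≠ ∞ := by
    apply ENNReal.rpow_ne_top_of_nonneg
    · rw [ENNReal.toReal_ofReal (by linarith)]
      simp only [ENNReal.toReal_one, div_one, sub_nonneg]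
      rw [div_le_one (by linarith)]; exact hp.le
    · exact measure_ne_top _ _
  refine ⟨c * m.toReal, by positivity, fun f => ?_⟩
  have hp1 : (1 : ℝ≥0∞) ≤ pe p := by simpa using hp.le
  have hfi : Integrable f (gaussian n β) := (Lp.memLp f).integrable hp1
  have hfi2 : Integrable f (ENNReal.ofReal c • gaussian n β) := hfi.smul_measure (by simp)
  refine ⟨hfi2.mono_measure hle, ?_⟩
  calc ∫ w in Metric.ball 0 r, ‖f w‖ ∂(gaussian n α)
      ≤ ∫ w, ‖f w‖ ∂(ENNReal.ofReal c • gaussian n β) :=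
        integral_mono_measure hle (Eventually.of_forall fun _ => norm_nonneg _) hfi2.norm
    _ = c * ∫ w, ‖f w‖ ∂(gaussian n β) := by
        rw [integral_smul_measure, ENNReal.toReal_ofReal hc0, smul_eq_mul]
    _ ≤ c * (m.toReal * ‖f‖) := by
        refine mul_le_mul_of_nonneg_left ?_ hc0
        rw [integral_norm_eq_lintegral_enorm hfi.1, ← eLpNorm_one_eq_lintegral_enorm,
          Lp.norm_def, mul_comm, ← ENNReal.toReal_mul]
        refine ENNReal.toReal_mono (ENNReal.mul_ne_top (Lp.eLpNorm_ne_top f) hmt) ?_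
        exact eLpNorm_le_eLpNorm_mul_rpow_measure_univ hp1 hfi.1
    _ = _ := by ring

lemma totallyBounded_of_approx {X : Type*} [PseudoMetricSpace X] {S : Set X}
    (h : ∀ ε > 0, ∃ t : Set X, TotallyBounded t ∧ ∀ x ∈ S, ∃ y ∈ t, dist x y < ε) :
    TotallyBounded S := by
  rw [Metric.totallyBounded_iff]
  intro ε hε
  obtain ⟨t, ht, hS⟩ := h (ε / 2) (by positivity)
  obtain ⟨u, hu, htu⟩ := Metric.totallyBounded_iff.1 ht (ε / 2) (by positivity)
  refine ⟨u, hu, fun x hx => ?_⟩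
  obtain ⟨y, hy, hxy⟩ := hS x hx
  have := htu hy
  simp only [Set.mem_iUnion, Metric.mem_ball] at this ⊢
  obtain ⟨v, hv, hyv⟩ := this
  exact ⟨v, hv, by linarith [dist_triangle x y v]⟩

/-- A simple function approximating the identity on a ball. -/
lemma exists_simple (n : ℕ) (r : ℝ) {δ : ℝ} (hδ : 0 < δ) :
    ∃ φ : SimpleFunc (Cn n) (Cn n), ∀ w ∈ Metric.ball (0 : Cn n) r, dist (φ w) w < δ := by
  have hcpt : IsCompact (Metric.closedBall (0 : Cn n) r) := isCompact_closedBall _ _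
  set e := TopologicalSpace.denseSeq (Cn n) with he
  obtain ⟨t, ht⟩ := hcpt.elim_finite_subcover (fun k => Metric.ball (e k) δ)
    (fun k => Metric.isOpen_ball) (by
      intro w _
      obtain ⟨k, hk⟩ := (TopologicalSpace.denseRange_denseSeq (Cn n)).exists_dist_lt w hδ
      exact Set.mem_iUnion.2 ⟨k, hk⟩)
  obtain ⟨N, hN⟩ := t.bddAbove
  refine ⟨SimpleFunc.nearestPt e N, fun w hw => ?_⟩
  obtain ⟨k, hk, hwk⟩ := Set.mem_iUnion₂.1 (ht (Metric.ball_subset_closedBall hw))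
  have h1 := SimpleFunc.edist_nearestPt_le e w (hN hk)
  rw [edist_dist, edist_dist, ENNReal.ofReal_le_ofReal_iff dist_nonneg] at h1
  rw [Metric.mem_ball, dist_comm] at hwk
  linarith

lemma P_cut_totallyBounded {p α : ℝ} [Fact (1 ≤ pe p)] (hp : 1 < p) (hα : 0 < α)
    (P : Lp ℂ (pe p) (gaussian n (p * α / 2)) →L[ℂ] Lp ℂ (pe p) (gaussian n (p * α / 2)))
    (hP : IsFockProjection n α (pe p) (gaussian n (p * α / 2)) P) {r : ℝ} (hr : 0 < r) :
    TotallyBounded ((fun f => P (cut (pe p) (gaussian n (p * α / 2))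
      (Metric.ball 0 r) (mball _ _) f)) '' Metric.closedBall 0 1) := by
  have hβ0 : 0 < p * α / 2 := by positivity
  obtain ⟨M, hM0, hM⟩ := local_L1 hp hα n r
  set G := (memLp_G n hp hα).toLp with hG
  apply totallyBounded_of_approx
  intro ε hε
  set K : ℝ := M * (α * Real.exp ((α * (r + 1) + 1) ^ 2 / α)) with hK
  have hK0 : 0 ≤ K := by positivity
  set δ : ℝ := min 1 (ε / (K * ‖G‖ + 1)) with hδdef
  have hδ : 0 < δ := by positivity
  have hδε : δ * K * ‖G‖ < ε := by
    have h1 : δ ≤ ε / (K * ‖G‖ + 1) := min_le_right _ _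
    rw [le_div_iff₀ (by positivity)] at h1
    nlinarith
  obtain ⟨φ, hφ⟩ := exists_simple n r hδ
  set k : Cn n → Lp ℂ (pe p) (gaussian n (p * α / 2)) := fun y => (memLp_kernel hp hα y).toLp
    with hk
  refine ⟨(fun c : φ.range → ℂ => ∑ y, c y • k y) '' Metric.closedBall 0 M, ?_, ?_⟩
  · refine ((isCompact_closedBall _ _).image ?_).totallyBounded
    fun_prop
  rintro _ ⟨f, hf, rfl⟩
  obtain ⟨hfi, hfM⟩ := hM f
  have hfM' : ∫ w in Metric.ball 0 r, ‖f w‖ ∂(gaussian n α) ≤ M := by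
    refine hfM.trans ?_
    have : ‖f‖ ≤ 1 := by simpa using hf
    nlinarith
  have hφm : ∀ y : Cn n, MeasurableSet (φ ⁻¹' {y}) := fun y => φ.measurableSet_fiber y
  set c : φ.range → ℂ := fun y =>
    ∫ w in Metric.ball 0 r, (φ ⁻¹' {(y : Cn n)}).indicator f w ∂(gaussian n α) with hc
  refine ⟨_, ⟨c, ?_, rfl⟩, ?_⟩
  · rw [mem_closedBall_zero_iff, pi_norm_le_iff_of_nonneg hM0]
    intro y
    refine (norm_integral_le_of_norm_le hfi.norm (Eventually.of_forall fun w => ?_)).trans hfM'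
    exact norm_indicator_le_norm_self _ _
  rw [dist_eq_norm]
  refine lt_of_le_of_lt ?_ hδε
  have hcoe : ∀ᵐ z ∂(gaussian n (p * α / 2)),
      (∑ y, c y • k y : Lp ℂ (pe p) (gaussian n (p * α / 2))) z
        = ∑ y, c y * cexp ((α : ℂ) * herm z (y : Cn n)) := by
    have h1 := Lp.coeFn_finsetSum (Finset.univ : Finset φ.range) (fun y => c y • k y)
    have h2 : ∀ᵐ z ∂(gaussian n (p * α / 2)), ∀ y : φ.range,
        (c y • k y : Lp ℂ (pe p) (gaussian n (p * α / 2))) z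
          = c y * cexp ((α : ℂ) * herm z (y : Cn n)) := by
      rw [ae_all_iff]
      intro y
      filter_upwards [Lp.coeFn_smul (c y) (k y), (memLp_kernel hp hα (y : Cn n)).coeFn_toLp]
        with z h1 h2
      rw [h1, Pi.smul_apply, h2, smul_eq_mul]
    filter_upwards [h1, h2] with z h1 h2
    rw [h1]
    simp only [Finset.sum_apply]
    exact Finset.sum_congr rfl fun y _ => h2 y
  have hcut : (cut (pe p) (gaussian n (p * α / 2)) (Metric.ball 0 r) (mball _ _) f : Cn n → ℂ)
      =ᵐ[gaussian n α] (Metric.ball 0 r).indicator f :=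
    (gaussian_ac n α).ae_le ((gaussian_ac' n hβ0).ae_le (coe_cut _ _ f))
  have hmain : ‖P (cut (pe p) (gaussian n (p * α / 2)) (Metric.ball 0 r) (mball _ _) f)
      - ∑ y, c y • k y‖ ≤ (δ * K) * ‖G‖ := by
    refine Lp.norm_le_mul_norm_of_ae_le_mul ?_
    filter_upwards [hcoe, hP.1 (cut (pe p) (gaussian n (p * α / 2)) (Metric.ball 0 r) (mball _ _) f),
      Lp.coeFn_sub (P (cut (pe p) (gaussian n (p * α / 2)) (Metric.ball 0 r) (mball _ _) f))
        (∑ y, c y • k y), (memLp_G n hp hα).coeFn_toLp] with z h1 h2 h3 h4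
    rw [h3, Pi.sub_apply, h1, h2, h4, Real.norm_eq_abs, abs_of_pos (Real.exp_pos _)]
    have e1 : ∫ w, (cut (pe p) (gaussian n (p * α / 2)) (Metric.ball 0 r) (mball _ _) f
          : Cn n → ℂ) w * cexp ((α : ℂ) * herm z w) ∂(gaussian n α)
        = ∫ w in Metric.ball 0 r, f w * cexp ((α : ℂ) * herm z w) ∂(gaussian n α) := by
      rw [← integral_indicator (mball _ _)]
      apply integral_congr_ae
      filter_upwards [hcut] with w hw
      rw [hw]
      by_cases h : w ∈ Metric.ball (0 : Cn n) r <;> simp [h]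
    have hind : ∀ y : Cn n, Integrable ((φ ⁻¹' {y}).indicator f)
        ((gaussian n α).restrict (Metric.ball 0 r)) := fun y => hfi.indicator (hφm y)
    have e2 : ∑ y, c y * cexp ((α : ℂ) * herm z (y : Cn n))
        = ∫ w in Metric.ball 0 r, ∑ y : φ.range, (φ ⁻¹' {(y : Cn n)}).indicator f w
            * cexp ((α : ℂ) * herm z (y : Cn n)) ∂(gaussian n α) := by
      rw [integral_finsetSum _ (fun (y : φ.range) _ => (hind (y : Cn n)).mul_const _)]
      simp only [hc, integral_mul_const]
    have e3 : ∀ w, ∑ y : φ.range, (φ ⁻¹' {(y : Cn n)}).indicator f w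
            * cexp ((α : ℂ) * herm z (y : Cn n)) = f w * cexp ((α : ℂ) * herm z (φ w)) := by
      intro w
      rw [Finset.sum_eq_single (⟨φ w, φ.mem_range_self w⟩ : φ.range)]
      · simp
      · intro y _ hy
        rw [Set.indicator_of_notMem, zero_mul]
        intro hw
        apply hy
        ext1
        exact (Set.mem_singleton_iff.1 hw).symm
      · simp
    have hbd : ∀ w ∈ Metric.ball (0 : Cn n) r,
        ‖cexp ((α : ℂ) * herm z w) - cexp ((α : ℂ) * herm z (φ w))‖
          ≤ δ * (α * Real.exp ((α * (r + 1) + 1) ^ 2 / α)) * Real.exp (α / 4 * ‖z‖ ^ 2) := by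
      intro w hw
      have hw1 : ‖w‖ < r := by simpa using hw
      have hw2 := hφ w hw
      have hδ1 : δ ≤ 1 := min_le_left _ _
      have hw3 : ‖φ w‖ ≤ r + 1 := by
        have : ‖φ w‖ ≤ ‖φ w - w‖ + ‖w‖ := by
          simpa using norm_add_le (φ w - w) w
        rw [dist_eq_norm] at hw2
        linarith
      have hh : ∀ v : Cn n, ‖v‖ ≤ r + 1 → ‖(α : ℂ) * herm z v‖ ≤ α * (r + 1) * ‖z‖ := by
        intro v hv
        rw [norm_mul, Complex.norm_real, Real.norm_eq_abs, abs_of_pos hα, mul_assoc]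
        refine mul_le_mul_of_nonneg_left ((norm_herm_le _ _).trans ?_) hα.le
        rw [mul_comm]
        exact mul_le_mul_of_nonneg_right hv (norm_nonneg _)
      have h5 := norm_exp_sub_le (hh w (by linarith)) (hh (φ w) hw3)
      have h6 : ‖(α : ℂ) * herm z w - (α : ℂ) * herm z (φ w)‖ ≤ α * δ * ‖z‖ := by
        rw [← mul_sub, ← herm_sub_right, norm_mul, Complex.norm_real, Real.norm_eq_abs,
          abs_of_pos hα, mul_assoc]
        refine mul_le_mul_of_nonneg_left ((norm_herm_le _ _).trans ?_) hα.le
        rw [mul_comm]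
        refine mul_le_mul_of_nonneg_right ?_ (norm_nonneg _)
        rw [← dist_eq_norm, dist_comm]
        exact hw2.le
      have h7 : ‖z‖ ≤ Real.exp ‖z‖ := by linarith [Real.add_one_le_exp ‖z‖]
      calc _ ≤ _ := h5
        _ ≤ Real.exp (α * (r + 1) * ‖z‖) * (α * δ * Real.exp ‖z‖) := by
            gcongr
            exact h6.trans (by gcongr)
        _ = δ * α * Real.exp ((α * (r + 1) + 1) * ‖z‖) := by
            rw [add_mul (α * (r + 1)), Real.exp_add, one_mul]; ring
        _ ≤ δ * α * (Real.exp ((α * (r + 1) + 1) ^ 2 / α) * Real.exp (α / 4 * ‖z‖ ^ 2)) := by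
            gcongr
            exact exp_le_G hα _ _
        _ = _ := by ring
    have hi2 : Integrable (fun w => f w * cexp ((α : ℂ) * herm z (φ w)))
        ((gaussian n α).restrict (Metric.ball 0 r)) := by
      have := integrable_finsetSum (Finset.univ : Finset φ.range)
        (fun (y : φ.range) _ => (hind (y : Cn n)).mul_const (cexp ((α : ℂ) * herm z (y : Cn n))))
      simpa only [e3] using this
    have hi1 : Integrable (fun w => f w * cexp ((α : ℂ) * herm z w))
        ((gaussian n α).restrict (Metric.ball 0 r)) := by
      refine hfi.mul_bdd (c := Real.exp (α * (‖z‖ * r))) ?_ ?_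
      · have := continuous_herm_right z
        fun_prop
      · rw [ae_restrict_iff' (mball _ _)]
        refine Eventually.of_forall fun w hw => ?_
        have hw1 : ‖w‖ < r := by simpa using hw
        rw [Complex.norm_exp]
        refine Real.exp_le_exp.2 ((Complex.re_le_norm _).trans ?_)
        rw [norm_mul, Complex.norm_real, Real.norm_eq_abs, abs_of_pos hα]
        refine mul_le_mul_of_nonneg_left ((norm_herm_le _ _).trans ?_) hα.le
        gcongr
    rw [e1, e2]
    simp only [e3]
    rw [← integral_sub hi1 hi2]
    refine (norm_integral_le_of_norm_le (hfi.norm.mul_const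
      (δ * (α * Real.exp ((α * (r + 1) + 1) ^ 2 / α)) * Real.exp (α / 4 * ‖z‖ ^ 2))) ?_).trans ?_
    · rw [ae_restrict_iff' (mball _ _)]
      refine Eventually.of_forall fun w hw => ?_
      rw [← mul_sub, norm_mul]
      exact mul_le_mul_of_nonneg_left (hbd w hw) (norm_nonneg _)
    · rw [integral_mul_const]
      calc _ ≤ M * (δ * (α * Real.exp ((α * (r + 1) + 1) ^ 2 / α))
            * Real.exp (α / 4 * ‖z‖ ^ 2)) :=
            mul_le_mul_of_nonneg_right hfM' (by positivity)
        _ = _ := by rw [hK]; ring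
  exact hmain

end FockAux

set_option maxHeartbeats 2000000 in
/-- If `H : F^p_α → L^p_α` is bounded, `H P_α` is band-dominated (with respect
to the Euclidean metric) and `‖C_z H C_{-z} g‖ → 0` as `|z| → ∞` for every `g ∈ F^p_α`,
then `H` is compact. -/
theorem stmt6 (n : ℕ) (hn : 1 ≤ n) (p α : ℝ) (hp : 1 < p) (hα : 0 < α)
    [Fact (1 ≤ pe p)]
    (μ : Measure (Cn n)) (hμ : μ = gaussian n (p * α / 2))
    (P : Lp ℂ (pe p) μ →L[ℂ] Lp ℂ (pe p) μ) (hP : IsFockProjection n α (pe p) μ P)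
    (C : Cn n → (Lp ℂ (pe p) μ →L[ℂ] Lp ℂ (pe p) μ))
    (hC : IsFockShiftFamily n α (pe p) μ C)
    (hCiso : ∀ (z : Cn n) (u : Lp ℂ (pe p) μ), ‖C z u‖ = ‖u‖)
    (hCinv : ∀ z : Cn n, (C z).comp (C (-z)) = ContinuousLinearMap.id ℂ (Lp ℂ (pe p) μ))
    (hCF : ∀ z : Cn n, ∀ u : Lp ℂ (pe p) μ,
      u ∈ fockSubmodule n (pe p) μ → C z u ∈ fockSubmodule n (pe p) μ)
    (H : ↥(fockSubmodule n (pe p) μ) →L[ℂ] Lp ℂ (pe p) μ)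
    (hband : IsBandDominated (fun z w => dist z w)
      (H.comp (P.codRestrict (fockSubmodule n (pe p) μ) hP.2.1)))
    (hconv : ∀ g : ↥(fockSubmodule n (pe p) μ),
      Tendsto (fun z : Cn n => ‖C z (H ⟨C (-z) ↑g, hCF (-z) ↑g g.2⟩)‖)
        (Bornology.cobounded (Cn n)) (𝓝 0)) :
    IsCompactOperator (⇑H) := by
  subst hμ
  have hp0 : 0 < p := by linarith
  have hβ0 : 0 < p * α / 2 := by positivity
  set Pr := P.codRestrict (fockSubmodule n (pe p) (gaussian n (p * α / 2))) hP.2.1 with hPr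
  set A := H.comp Pr with hA
  -- total boundedness in the Fock space
  have tbF : ∀ r : ℝ, 0 < r → TotallyBounded ((fun f => Pr (FockAux.cut (pe p)
      (gaussian n (p * α / 2)) (Metric.ball 0 r) (FockAux.mball _ _) f)) ''
        Metric.closedBall 0 1) := by
    intro r hr
    have h := FockAux.P_cut_totallyBounded hp hα P hP hr
    rw [← totallyBounded_image_iff (f := (Subtype.val :
      fockSubmodule n (pe p) (gaussian n (p * α / 2)) → _)) isometry_subtype_coe.isUniformInducing, Set.image_image]
    exact h
  -- smallness of `A` on far away balls
  have small : ∀ r : ℝ, 0 < r → ∀ ε : ℝ, 0 < ε → ∃ R : ℝ, ∀ z : Cn n, R ≤ ‖z‖ → ∀ f,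
      ‖A (FockAux.cut _ _ (Metric.ball z r) (FockAux.mball _ _) f)‖
        ≤ ε * ‖FockAux.cut _ _ (Metric.ball z r) (FockAux.mball _ _) f‖ := by
    intro r hr ε hε
    obtain ⟨t, ht, htS⟩ := Metric.totallyBounded_iff.1 (tbF r hr) (ε / (2 * (‖H‖ + 1)))
      (by positivity)
    have hev : ∀ᶠ z in cobounded (Cn n), ∀ y ∈ t,
        ‖C z (H ⟨C (-z) (y : Lp ℂ (pe p) (gaussian n (p * α / 2))), hCF (-z) _ y.2⟩)‖ < ε / 2 :=
      (Filter.eventually_all_finite ht).2 fun y _ =>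
        (hconv y).eventually_lt_const (by positivity)
    obtain ⟨R, -, hR⟩ := (hasBasis_cobounded_norm (E := Cn n)).eventually_iff.1 hev
    refine ⟨R, fun z hz f => ?_⟩
    set g := FockAux.cut (pe p) (gaussian n (p * α / 2)) (Metric.ball z r) (FockAux.mball _ _) f
      with hg
    have hRz : ∀ y ∈ t, ‖H ⟨C z (y : Lp ℂ (pe p) (gaussian n (p * α / 2))),
        hCF z _ y.2⟩‖ < ε / 2 := by
      intro y hy
      have h := hR (x := -z) (by simpa using hz) y hy
      rw [hCiso] at h
      simpa only [neg_neg] using h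
    set Cz : fockSubmodule n (pe p) (gaussian n (p * α / 2)) →L[ℂ]
        fockSubmodule n (pe p) (gaussian n (p * α / 2)) :=
      ((C z).comp (Submodule.subtypeL _)).codRestrict _ (fun y => hCF z _ y.2) with hCz
    have hCzn : ∀ y, ‖Cz y‖ = ‖y‖ := fun y => hCiso z _
    set u := C (-z) g with hu
    have hun : ‖u‖ = ‖g‖ := hCiso _ _
    have hzu : C z u = g := by
      have := congrArg (fun T => T g) (hCinv z)
      simpa using this
    have hcu : FockAux.cut (pe p) (gaussian n (p * α / 2)) (Metric.ball 0 r)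
        (FockAux.mball _ _) u = u := by
      have h := FockAux.C_cut hβ0 C hC (-z) z r g
      simp only [add_neg_cancel] at h
      rw [← h, hg, FockAux.cut_cut]
    set L : Lp ℂ (pe p) (gaussian n (p * α / 2)) →L[ℂ] Lp ℂ (pe p) (gaussian n (p * α / 2)) :=
      (H.comp Cz).comp (Pr.comp (FockAux.cut (pe p) (gaussian n (p * α / 2)) (Metric.ball 0 r)
        (FockAux.mball _ _))) with hL
    have hLu : A g = L u := by
      have e : Pr g = Cz (Pr u) := by
        apply Subtype.ext
        change P g = C z (P u)
        rw [← FockAux.P_comm hβ0 hα P hP C hC, hzu]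
      simp only [hA, hL, ContinuousLinearMap.comp_apply]
      rw [hcu, e]
    have hLb : ∀ v, ‖v‖ ≤ 1 → ‖L v‖ ≤ ε := by
      intro v hv
      have hmem := htS ⟨v, by simpa using hv, rfl⟩
      simp only [Set.mem_iUnion, Metric.mem_ball] at hmem
      obtain ⟨y, hy, hd⟩ := hmem
      set x := Pr (FockAux.cut (pe p) (gaussian n (p * α / 2)) (Metric.ball 0 r)
        (FockAux.mball _ _) v) with hx
      have e1 : L v = H (Cz (x - y)) + H (Cz y) := by
        rw [map_sub, map_sub, sub_add_cancel]; rfl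
      have e2 : ‖H (Cz y)‖ < ε / 2 := hRz y hy
      have e3 : ‖H (Cz (x - y))‖ ≤ ‖H‖ * (ε / (2 * (‖H‖ + 1))) := by
        refine (H.le_opNorm _).trans ?_
        rw [hCzn, ← dist_eq_norm]
        gcongr
      have e4 : ‖H‖ * (ε / (2 * (‖H‖ + 1))) ≤ ε / 2 := by
        rw [mul_div_assoc', div_le_div_iff₀ (by positivity) (by norm_num)]
        nlinarith [norm_nonneg H]
      rw [e1]
      linarith [norm_add_le (H (Cz (x - y))) (H (Cz y))]
    rw [hLu, ← hun]
    refine L.le_of_opNorm_le ?_ u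
    exact L.opNorm_le_of_unit_norm hε.le fun v hv => hLb v hv.le
  -- compactness of the truncations
  have hcomp : ∀ r : ℝ, 0 < r → IsCompactOperator (A.comp (FockAux.cut (pe p)
      (gaussian n (p * α / 2)) (Metric.ball 0 r) (FockAux.mball _ _))) := by
    intro r hr
    have h := ((tbF r hr).image H.uniformContinuous).closure
    rw [Set.image_image] at h
    exact (isCompactOperator_iff_isCompact_closure_image_closedBall (A.comp (FockAux.cut (pe p)
      (gaussian n (p * α / 2)) (Metric.ball 0 r) (FockAux.mball _ _))).toLinearMap
        one_pos).2 (h.isCompact_of_isClosed isClosed_closure)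
  -- convergence of the truncations
  have hlim : Tendsto (fun r : ℝ => A.comp (FockAux.cut (pe p)
      (gaussian n (p * α / 2)) (Metric.ball 0 r) (FockAux.mball _ _))) atTop (𝓝 A) := by
    rw [Metric.tendsto_atTop]
    intro η hη
    set N : ℝ := ((3 : ℝ) ^ Module.finrank ℝ (Cn n)) ^ (1 / p) with hN
    have hN0 : 0 ≤ N := by positivity
    set ε : ℝ := η / (2 * (2 * N + 1)) with hε
    have hε0 : 0 < ε := by positivity
    obtain ⟨B, ⟨ω, hω, hB⟩, hAB⟩ := Metric.mem_closure_iff.1 hband ε hε0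
    obtain ⟨R, hR⟩ := small (3 * ω) (by positivity) ε hε0
    refine ⟨R + 3 * ω, fun r hr => ?_⟩
    have hABn : ‖A - B‖ ≤ ε := by rw [← dist_eq_norm]; exact hAB.le
    have hdiff : ∀ g, ‖A g - B g‖ ≤ ε * ‖g‖ := fun g => (A - B).le_of_opNorm_le hABn g
    have hfin : ‖A.comp (FockAux.cut (pe p)
      (gaussian n (p * α / 2)) (Metric.ball 0 r) (FockAux.mball _ _)) - A‖ ≤ (2 * N + 1) * ε := by
      refine ContinuousLinearMap.opNorm_le_bound _ (by positivity) fun f => ?_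
      set h := FockAux.cut (pe p) (gaussian n (p * α / 2)) (Metric.ball 0 r)ᶜ
        (FockAux.mball _ _).compl f with hh
      have hhf : ‖h‖ ≤ ‖f‖ := FockAux.norm_cut_le _ _ _
      have e1 : (A.comp (FockAux.cut (pe p)
          (gaussian n (p * α / 2)) (Metric.ball 0 r) (FockAux.mball _ _)) - A) f = - A h := by
        have := congrArg A (FockAux.cut_add_compl (q := pe p) (μ := gaussian n (p * α / 2))
          (Metric.ball 0 r) (FockAux.mball _ _) f)
        rw [map_add] at this
        rw [_root_.sub_apply, ContinuousLinearMap.comp_apply, ← this]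
        abel
      have e2 : ‖B h‖ ≤ N * (2 * ε) * ‖h‖ := by
        refine FockAux.band_localization hp0 B hω hB (by positivity) h fun z => ?_
        by_cases hz : R ≤ ‖z‖
        · have h1 := hR z hz h
          set g := FockAux.cut (pe p) (gaussian n (p * α / 2)) (Metric.ball z (3 * ω))
            (FockAux.mball _ _) h
          have h2 := hdiff g
          have h3 : ‖B g‖ ≤ ‖A g‖ + ‖A g - B g‖ := by
            have := norm_sub_le (A g) (A g - B g)
            simpa using this
          linarith
        · rw [hh, FockAux.cut_disj]
          · simp
          · intro w hw hw2
            apply hw2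
            rw [Metric.mem_ball] at hw ⊢
            have := dist_triangle w z 0
            rw [dist_zero_right z] at this
            push Not at hz
            linarith
      have e3 : ‖A h‖ ≤ ‖B h‖ + ‖A h - B h‖ := by
        have := norm_add_le (B h) (A h - B h)
        simpa using this
      rw [e1, norm_neg]
      have e4 := hdiff h
      calc ‖A h‖ ≤ (2 * N + 1) * ε * ‖h‖ := by linarith
        _ ≤ _ := by gcongr
    rw [dist_eq_norm]
    refine hfin.trans_lt ?_
    have : (2 * N + 1) * ε = η / 2 := by rw [hε]; field_simp
    linarith
  have hAc : IsCompactOperator A :=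
    isCompactOperator_of_tendsto hlim ((eventually_gt_atTop 0).mono hcomp)
  have hHA : (H : fockSubmodule n (pe p) (gaussian n (p * α / 2)) → _)
      = A ∘ (Submodule.subtypeL (fockSubmodule n (pe p) (gaussian n (p * α / 2)))) := by
    ext1 g
    have : Pr (g : Lp ℂ (pe p) (gaussian n (p * α / 2))) = g := Subtype.ext (hP.2.2 _ g.2)
    change H g = H (Pr (g : Lp ℂ (pe p) (gaussian n (p * α / 2))))
    rw [this]
  rw [hHA]
  exact hAc.comp_clm _
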